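/- Let a > 0 and let x, p ∈ ℝ be nonzero. Then the Abel limit of the overlap series between the position eigenvector v(x) and the momentum eigenvector w(p) exists and equals lim_{t→1⁻} Σ_{n=0}^{∞} iⁿ·β_n(x)·β_n(p)·tⁿ = (|xp|^{a−1/2} / (2^a·Γ(a))) · ( ₀F₁(−; a; −x²p²/4) + (ixp/(2a))·₀F₁(−; a+1; −x²p²/4) ). -/

import Mathlib

/-- Pochhammer symbol `(c)_k` in `ℂ`. -/
noncomputable def pochC (c : ℂ) (k : ℕ) : ℂ := ∏ j ∈ Finset.range k, (c + j)

/-- Pochhammer symbol `(c)_k` in `ℝ`. -/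
noncomputable def pochR (c : ℝ) (k : ℕ) : ℝ := ∏ j ∈ Finset.range k, (c + j)

/-- The prefactor `ℬ₀(x) = |x|^{a−1/2}·e^{−x²/2}/√Γ(a)`. -/
noncomputable def calB0 (a x : ℝ) : ℝ :=
  |x| ^ (a - 1 / 2) * Real.exp (-x ^ 2 / 2) / Real.sqrt (Real.Gamma a)

/-- The prefactor `ℬ₁(x) = x·|x|^{a−1/2}·e^{−x²/2}/√Γ(a+1)`. -/
noncomputable def calB1 (a x : ℝ) : ℝ :=
  x * |x| ^ (a - 1 / 2) * Real.exp (-x ^ 2 / 2) / Real.sqrt (Real.Gamma (a + 1))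

/-- The coefficient `β_{2n}(x) = (−1)ⁿ √((a)_n/n!) ℬ₀(x) ₁F₁(−n; a; x²)`,
a normalized generalized Hermite function. -/
noncomputable def betaEv (a x : ℝ) (n : ℕ) : ℂ :=
  (-1) ^ n * (Real.sqrt (pochR a n / n.factorial) : ℂ) * (calB0 a x : ℂ) *
    ∑ k ∈ Finset.range (n + 1),
      pochC (-(n : ℂ)) k / (pochC (a : ℂ) k * (k.factorial : ℂ)) * (x : ℂ) ^ (2 * k)

/-- The coefficient `β_{2n+1}(x) = (−1)ⁿ √((a+1)_n/n!) ℬ₁(x) ₁F₁(−n; a+1; x²)`,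
a normalized generalized Hermite function. -/
noncomputable def betaOdd (a x : ℝ) (n : ℕ) : ℂ :=
  (-1) ^ n * (Real.sqrt (pochR (a + 1) n / n.factorial) : ℂ) * (calB1 a x : ℂ) *
    ∑ k ∈ Finset.range (n + 1),
      pochC (-(n : ℂ)) k / (pochC ((a : ℂ) + 1) k * (k.factorial : ℂ)) * (x : ℂ) ^ (2 * k)

/-- The full family `β_m(x)`, combining even and odd indices. -/
noncomputable def betaFn (a x : ℝ) (m : ℕ) : ℂ :=
  if Even m then betaEv a x (m / 2) else betaOdd a x (m / 2)

/-- The confluent hypergeometric limit function `₀F₁(−; c; z) = Σ z^k/((c)_k·k!)`. -/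
noncomputable def hyp0F1 (c z : ℂ) : ℂ := ∑' k : ℕ, z ^ k / (pochC c k * (k.factorial : ℂ))

section HilleHardy

open Finset

lemma pochR_zero (c : ℝ) : pochR c 0 = 1 := by simp [pochR]

lemma pochR_succ (c : ℝ) (k : ℕ) : pochR c (k + 1) = pochR c k * (c + k) := by
  simp [pochR, prod_range_succ]

lemma pochR_add (c : ℝ) (k l : ℕ) : pochR c (k + l) = pochR c k * pochR (c + k) l := by
  induction l with
  | zero => simp [pochR_zero]
  | succ l ih => rw [← add_assoc, pochR_succ, ih, pochR_succ]; push_cast; ring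

lemma pochR_succ_left (c : ℝ) (k : ℕ) : pochR c (k + 1) = c * pochR (c + 1) k := by
  rw [add_comm, pochR_add]; simp [pochR]

lemma pochR_pos {c : ℝ} (hc : 0 < c) (k : ℕ) : 0 < pochR c k :=
  prod_pos fun j _ => by positivity

lemma min_le_pochR {c : ℝ} (hc : 0 < c) (k : ℕ) : min 1 c ≤ pochR c k := by
  cases k with
  | zero => simp [pochR_zero]
  | succ k =>
    rw [pochR_succ_left]
    have h : 1 ≤ pochR (c + 1) k :=
      Finset.one_le_prod fun j _ => by linarith [hc, (Nat.cast_nonneg j : (0 : ℝ) ≤ j)]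
    exact (min_le_right _ _).trans (le_mul_of_one_le_right hc.le h)

lemma pochR_div_factorial (c : ℝ) (n : ℕ) :
    pochR c n / n.factorial = Ring.choose (c + n - 1) n := by
  have h : pochR c n = (ascPochhammer ℝ n).eval c := by
    induction n with
    | zero => simp [pochR_zero]
    | succ n ih => rw [pochR_succ, ih, ascPochhammer_succ_eval]
  rw [← Ring.multichoose_eq, h, ← Polynomial.ascPochhammer_smeval_eq_eval,
    ← Ring.factorial_nsmul_multichoose_eq_ascPochhammer, nsmul_eq_mul]
  field_simp

lemma hasSum_pochR_div_factorial (a : ℝ) {z : ℝ} (hz : |z| < 1) :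
    HasSum (fun n : ℕ => pochR a n / n.factorial * z ^ n) ((1 - z) ^ (-a)) := by
  have h := (Real.one_div_one_sub_rpow_hasFPowerSeriesOnBall_zero a).hasSum
    (y := z) (by simpa [enorm_eq_nnnorm] using! hz)
  have h1 : 0 ≤ 1 - z := by linarith [(abs_lt.1 hz).2]
  rw [zero_add, one_div, ← Real.rpow_neg h1] at h
  refine h.congr_fun fun n => ?_
  simp [pochR_div_factorial, mul_comm]

lemma cast_factorial_add (m l : ℕ) :
    ((m + l).factorial : ℝ) = (m + l).choose m * m.factorial * l.factorial := by
  rw [← Nat.add_choose_mul_factorial_mul_factorial m l, ← Nat.choose_symm_add]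
  push_cast
  ring

lemma cast_choose_add_ne_zero (m l : ℕ) : ((m + l).choose m : ℝ) ≠ 0 :=
  Nat.cast_ne_zero.2 (Nat.choose_pos (Nat.le_add_right m l)).ne'

lemma hasSum_pochR_choose (a : ℝ) (s : ℕ) {z : ℝ} (hz : |z| < 1) :
    HasSum (fun n : ℕ => pochR a n / n.factorial * n.choose s * z ^ n)
      (pochR a s / s.factorial * z ^ s * ((1 - z) ^ (-a) * (1 - z)⁻¹ ^ s)) := by
  have h1 : 0 < 1 - z := by linarith [(abs_lt.1 hz).2]
  have h := (hasSum_pochR_div_factorial (a + s) hz).mul_left (pochR a s / s.factorial * z ^ s)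
  rw [show -(a + s) = -a - (s : ℝ) by ring, Real.rpow_sub h1, Real.rpow_natCast,
    div_eq_mul_inv (_ ^ _), ← inv_pow] at h
  rw [← (add_left_injective s).hasSum_iff]
  · refine h.congr_fun fun n => ?_
    have hc := cast_choose_add_ne_zero s n
    simp only [Function.comp]
    rw [add_comm n s, cast_factorial_add, pochR_add]
    field_simp
    ring
  · intro n hn
    have : n < s := by
      by_contra! h
      exact hn ⟨n - s, by simp; omega⟩
    simp [Nat.choose_eq_zero_of_lt this]

lemma choose_mul_choose_eq_sum (n j k : ℕ) :
    n.choose j * n.choose k =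
      ∑ q ∈ antidiagonal j, k.choose q.1 * ((k + q.2).choose k * n.choose (k + q.2)) := by
  rcases lt_or_ge n k with h | h
  · rw [Nat.choose_eq_zero_of_lt h, mul_zero, eq_comm]
    refine sum_eq_zero fun q _ => ?_
    rw [Nat.choose_eq_zero_of_lt (by omega : n < k + q.2)]; simp
  · obtain ⟨d, rfl⟩ := Nat.exists_eq_add_of_le h
    rw [Nat.add_choose_eq k d j, sum_mul]
    refine sum_congr rfl fun q _ => ?_
    have := Nat.choose_mul (n := k + d) (k := k + q.2) (s := k) (by omega)
    simp only [Nat.add_sub_cancel_left] at this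
    rw [mul_comm ((k + q.2).choose k), this]; ring

lemma sum_antidiagonal_choose_pochR (z : ℝ) (k : ℕ) : ∀ (a : ℝ) (j : ℕ),
    ∑ q ∈ antidiagonal j, (k.choose q.1 * (1 - z) ^ q.1) *
        (pochR (a + k) q.2 / q.2.factorial * z ^ q.2) =
      ∑ q ∈ antidiagonal j, k.choose q.1 *
        (pochR (a + q.1) q.2 / q.2.factorial * z ^ q.2) := by
  let B : ℝ → PowerSeries ℝ := fun c => .mk fun r => pochR c r / r.factorial * z ^ r
  let M : ℕ → PowerSeries ℝ := fun k => .mk fun i => k.choose i * (1 - z) ^ i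
  let R : ℕ → ℝ → PowerSeries ℝ := fun k a => .mk fun j => ∑ q ∈ antidiagonal j,
    k.choose q.1 * (pochR (a + q.1) q.2 / q.2.factorial * z ^ q.2)
  have hB (c : ℝ) : B c = (1 - PowerSeries.C z * .X) * B (c + 1) := by
    ext r
    rw [sub_mul, one_mul, mul_assoc, map_sub, PowerSeries.coeff_C_mul]
    cases r with
    | zero => simp [B, pochR_zero]
    | succ r =>
      rw [PowerSeries.coeff_succ_X_mul]
      simp only [B, PowerSeries.coeff_mk]
      rw [pochR_succ_left, pochR_succ, Nat.factorial_succ]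
      push_cast
      field_simp
      ring
  have hM (k : ℕ) : M (k + 1) = (1 + PowerSeries.C (1 - z) * .X) * M k := by
    ext r
    rw [add_mul, one_mul, mul_assoc, map_add, PowerSeries.coeff_C_mul]
    cases r with
    | zero => simp [M]
    | succ r =>
      rw [PowerSeries.coeff_succ_X_mul]
      simp only [M, PowerSeries.coeff_mk]
      rw [Nat.choose_succ_succ]
      push_cast
      ring
  have hR (k : ℕ) (a : ℝ) : R (k + 1) a = R k a + .X * R k (a + 1) := by
    ext r
    rw [map_add]
    cases r with
    | zero => simp [R]
    | succ r =>
      rw [PowerSeries.coeff_succ_X_mul]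
      simp only [R, PowerSeries.coeff_mk]
      rw [Nat.sum_antidiagonal_succ, Nat.sum_antidiagonal_succ, add_assoc, ← sum_add_distrib]
      congr 1
      · simp
      · refine sum_congr rfl fun q _ => ?_
        rw [Nat.choose_succ_succ]
        push_cast
        rw [show a + 1 + (q.1 : ℝ) = a + (q.1 + 1) by ring]
        ring
  have key : ∀ a : ℝ, M k * B (a + k) = R k a := by
    induction k with
    | zero =>
      intro a
      ext j
      rw [PowerSeries.coeff_mul]
      simp only [M, B, R, PowerSeries.coeff_mk]
      refine sum_congr rfl fun q _ => ?_
      rcases q with ⟨_ | i, r⟩ <;> simp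
    | succ k ih =>
      intro a
      rw [hR, ← ih, ← ih, hM, hB (a + k)]
      push_cast
      rw [show a + 1 + (k : ℝ) = a + k + 1 by ring, show a + ((k : ℝ) + 1) = a + k + 1 by ring,
        map_sub, map_one]
      ring
  intro a j
  have := congrArg (PowerSeries.coeff j) (key a)
  rw [PowerSeries.coeff_mul] at this
  simpa only [M, B, R, PowerSeries.coeff_mk] using this

/-- The real counterpart of `hyp0F1`. -/
noncomputable def hyp0F1R (c y : ℝ) : ℝ := ∑' k : ℕ, y ^ k / (pochR c k * k.factorial)

lemma norm_pow_div_pochR_le {c : ℝ} (hc : 0 < c) {y r : ℝ} (hy : |y| ≤ r) (k : ℕ) :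
    ‖y ^ k / (pochR c k * k.factorial)‖ ≤ (min 1 c)⁻¹ * (r ^ k / k.factorial) := by
  have h0 : 0 < min 1 c := lt_min one_pos hc
  have h1 := min_le_pochR hc k
  have hr := (abs_nonneg y).trans hy
  rw [norm_div, norm_mul, norm_pow, Real.norm_eq_abs, Real.norm_of_nonneg (h0.le.trans h1),
    Real.norm_natCast, inv_mul_eq_div, div_div, mul_comm]
  gcongr

lemma summable_pow_div_pochR {c : ℝ} (hc : 0 < c) (y : ℝ) :
    Summable fun k : ℕ => ‖y ^ k / (pochR c k * k.factorial)‖ :=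
  .of_nonneg_of_le (fun _ => norm_nonneg _) (norm_pow_div_pochR_le hc le_rfl)
    ((Real.summable_pow_div_factorial _).mul_left _)

lemma continuous_hyp0F1R {c : ℝ} (hc : 0 < c) : Continuous (hyp0F1R c) := by
  rw [continuous_iff_continuousAt]
  intro y
  have h : ∀ᶠ x in nhds y, |x| ≤ |y| + 1 :=
    continuous_abs.continuousAt.eventually (eventually_le_nhds (lt_add_one |y|))
  exact tendsto_tsum_of_dominated_convergence
    ((Real.summable_pow_div_factorial (|y| + 1)).mul_left (min 1 c)⁻¹)
    (fun k => (show Continuous fun x : ℝ => x ^ k / (pochR c k * k.factorial) by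
      fun_prop).tendsto y)
    (h.mono fun x hx k => norm_pow_div_pochR_le hc hx k)

/-- The Laguerre polynomial `₁F₁(−n; a; −x)`, normalized to `1` at the origin. -/
noncomputable def laguerreR (a : ℝ) (n : ℕ) (x : ℝ) : ℝ :=
  ∑ j ∈ range (n + 1), n.choose j / pochR a j * x ^ j

/-- The closed form of the Hille–Hardy series. -/
noncomputable def hilleHardyKernel (a z x y : ℝ) : ℝ :=
  (1 - z) ^ (-a) * (Real.exp (x * z / (1 - z)) * Real.exp (y * z / (1 - z)) *
    hyp0F1R a (x * y * z / (1 - z) ^ 2))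

/-- The terms of the Hille–Hardy series after expanding both Laguerre polynomials. -/
noncomputable def hilleHardyTerm (a z x y : ℝ) (j k n : ℕ) : ℝ :=
  (x ^ j / pochR a j * (y ^ k / pochR a k)) *
    (pochR a n / n.factorial * (n.choose j * n.choose k) * z ^ n)

/-- The sum over `n` of the terms of the Hille–Hardy series. -/
noncomputable def hilleHardyCoeff (a z x y : ℝ) (j k : ℕ) : ℝ :=
  ∑ q ∈ antidiagonal j, (1 - z) ^ (-a) * ((1 - z)⁻¹ ^ (j + k) * z ^ (k + q.2) * x ^ j * y ^ k *
    k.choose q.1 / (pochR a q.1 * k.factorial * q.2.factorial))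

lemma hasSum_hilleHardyTerm {a z : ℝ} (ha : 0 < a) (hz : |z| < 1) (x y : ℝ) (j k : ℕ) :
    HasSum (hilleHardyTerm a z x y j k) (hilleHardyCoeff a z x y j k) := by
  have h1 : 0 < 1 - z := by linarith [(abs_lt.1 hz).2]
  have h := (hasSum_sum fun q (_ : q ∈ antidiagonal j) =>
    (hasSum_pochR_choose a (k + q.2) hz).mul_left
      (k.choose q.1 * (k + q.2).choose k : ℝ)).mul_left (x ^ j / pochR a j * (y ^ k / pochR a k))
  have h1' := h1.ne'
  have hj := (pochR_pos ha j).ne'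
  have hk := (pochR_pos ha k).ne'
  have e : ∑ q ∈ antidiagonal j, (k.choose q.1 * (k + q.2).choose k : ℝ) *
      (pochR a (k + q.2) / (k + q.2).factorial * z ^ (k + q.2) *
        ((1 - z) ^ (-a) * (1 - z)⁻¹ ^ (k + q.2))) =
      (1 - z) ^ (-a) * ((1 - z)⁻¹ ^ (j + k) * pochR a k * z ^ k / k.factorial) *
      ∑ q ∈ antidiagonal j, (k.choose q.1 * (1 - z) ^ q.1) *
      (pochR (a + k) q.2 / q.2.factorial * z ^ q.2) := by
    rw [mul_sum]
    refine sum_congr rfl fun q hq => ?_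
    obtain rfl := mem_antidiagonal.1 hq
    have hc := cast_choose_add_ne_zero k q.2
    rw [cast_factorial_add, pochR_add]
    simp only [inv_pow, pow_add]
    field_simp
  have hval : hilleHardyCoeff a z x y j k = x ^ j / pochR a j * (y ^ k / pochR a k) *
      ∑ q ∈ antidiagonal j, (k.choose q.1 * (k + q.2).choose k : ℝ) *
      (pochR a (k + q.2) / (k + q.2).factorial * z ^ (k + q.2) *
        ((1 - z) ^ (-a) * (1 - z)⁻¹ ^ (k + q.2))) := by
    rw [e, sum_antidiagonal_choose_pochR z k a j, mul_sum, mul_sum, hilleHardyCoeff]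
    refine sum_congr rfl fun q hq => ?_
    obtain rfl := mem_antidiagonal.1 hq
    have hq := (pochR_pos ha q.1).ne'
    have hq2 : pochR (a + q.1) q.2 ≠ 0 := (pochR_pos (by positivity) q.2).ne'
    rw [pochR_add a q.1 q.2]
    field_simp
    ring
  rw [hval]
  refine h.congr_fun fun n => ?_
  rw [hilleHardyTerm, ← Nat.cast_mul, choose_mul_choose_eq_sum]
  push_cast
  rw [mul_sum, sum_mul]
  congr 1
  exact sum_congr rfl fun q _ => by ring

lemma hasSum_mul_mul_of_summable_norm {f g h : ℕ → ℝ} {s t u : ℝ} (hf : HasSum f s)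
    (hg : HasSum g t) (hh : HasSum h u) (hf' : Summable fun k => ‖f k‖)
    (hg' : Summable fun k => ‖g k‖) (hh' : Summable fun k => ‖h k‖) :
    HasSum (fun p : ℕ × (ℕ × ℕ) => f p.1 * (g p.2.1 * h p.2.2)) (s * (t * u)) := by
  have h2 : HasSum (fun p : ℕ × ℕ => g p.1 * h p.2) (t * u) :=
    hg.mul hh (summable_mul_of_summable_norm hg' hh')
  have h3 : Summable (fun p : ℕ × ℕ => ‖g p.1 * h p.2‖) := hg'.mul_norm hh'
  exact hf.mul h2 (summable_mul_of_summable_norm (g := fun p : ℕ × ℕ => g p.1 * h p.2) hf' h3)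

lemma pow_mul_pow_mul_pow_eq (u z x y : ℝ) (m l k : ℕ) :
    u⁻¹ ^ ((m + l) + (m + k)) * z ^ (m + k + l) * x ^ (m + l) * y ^ (m + k) =
      (x * y * z / u ^ 2) ^ m * (x * z / u) ^ l * (y * z / u) ^ k := by
  simp only [div_eq_mul_inv, ← inv_pow]
  generalize u⁻¹ = v
  ring

lemma hasSum_hilleHardyCoeff {a z : ℝ} (ha : 0 < a) (hz : |z| < 1) (x y : ℝ) :
    HasSum (fun p : ℕ × ℕ => hilleHardyCoeff a z x y p.1 p.2)
      (hilleHardyKernel a z x y) := by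
  have h1 : 0 < 1 - z := by linarith [(abs_lt.1 hz).2]
  have h1' := h1.ne'
  let F : ℕ × (ℕ × ℕ) → ℝ := fun p => (1 - z) ^ (-a) * ((1 - z)⁻¹ ^ (p.2.1 + p.2.2) *
    z ^ (p.2.2 + (p.2.1 - p.1)) * x ^ p.2.1 * y ^ p.2.2 * p.2.1.choose p.1 * p.2.2.choose p.1 *
    p.1.factorial / (pochR a p.1 * p.2.1.factorial * p.2.2.factorial))
  have hF : HasSum F (hilleHardyKernel a z x y) := by
    have hexp (u : ℝ) : HasSum (fun k : ℕ => u ^ k / k.factorial) (Real.exp u) := by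
      simpa [Real.exp_eq_exp_ℝ] using NormedSpace.expSeries_div_hasSum_exp (𝔸 := ℝ) u
    have hn (u : ℝ) : Summable fun k : ℕ => ‖u ^ k / k.factorial‖ :=
      (Real.summable_pow_div_factorial u).norm
    have h0 : HasSum (fun k : ℕ => (x * y * z / (1 - z) ^ 2) ^ k / (pochR a k * k.factorial))
        (hyp0F1R a (x * y * z / (1 - z) ^ 2)) := (summable_pow_div_pochR ha _).of_norm.hasSum
    have h := (hasSum_mul_mul_of_summable_norm h0 (hexp (x * z / (1 - z))) (hexp (y * z / (1 - z)))
      (summable_pow_div_pochR ha _) (hn _) (hn _)).mul_left ((1 - z) ^ (-a))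
    rw [mul_comm (hyp0F1R _ _), ← hilleHardyKernel] at h
    let e : ℕ × (ℕ × ℕ) → ℕ × (ℕ × ℕ) := fun p => (p.1, (p.1 + p.2.1, p.1 + p.2.2))
    have he : Function.Injective e := by
      rintro ⟨m, l, k⟩ ⟨m', l', k'⟩ h
      simp only [e, Prod.mk.injEq] at h ⊢
      omega
    rw [← he.hasSum_iff]
    · refine h.congr_fun fun ⟨m, l, k⟩ => ?_
      have hc (m l : ℕ) : (((m + l).choose m : ℕ) : ℝ) / (m + l).factorial =
          1 / (m.factorial * l.factorial) := by
        have := cast_choose_add_ne_zero m l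
        rw [cast_factorial_add]
        field_simp
      have hm := (pochR_pos ha m).ne'
      calc F (e (m, l, k)) = (1 - z) ^ (-a) * ((1 - z)⁻¹ ^ ((m + l) + (m + k)) *
            z ^ (m + k + l) * x ^ (m + l) * y ^ (m + k) * (((m + l).choose m : ℕ) /
            (m + l).factorial) * (((m + k).choose m : ℕ) / (m + k).factorial) *
            m.factorial / pochR a m) := by
              simp only [F, e, Nat.add_sub_cancel_left]
              field_simp
        _ = _ := by
              rw [hc, hc, pow_mul_pow_mul_pow_eq]
              generalize (x * y * z / (1 - z) ^ 2) ^ m = A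
              generalize (x * z / (1 - z)) ^ l = B
              generalize (y * z / (1 - z)) ^ k = C
              generalize (1 - z) ^ (-a) = D
              field_simp
    · rintro ⟨m, j, k⟩ hp
      have : j < m ∨ k < m := by
        by_contra! h
        exact hp ⟨(m, (j - m, k - m)), by simp [e]; omega⟩
      rcases this with h | h <;> simp [F, Nat.choose_eq_zero_of_lt h]
  refine ((Equiv.prodComm _ _).hasSum_iff.2 hF).prod_fiberwise fun ⟨j, k⟩ => ?_
  have hs : ∑ m ∈ range (j + 1), F (m, (j, k)) = hilleHardyCoeff a z x y j k := by
    rw [hilleHardyCoeff, Nat.sum_antidiagonal_eq_sum_range_succ_mk]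
    refine sum_congr rfl fun m hm => ?_
    have hmj : m ≤ j := Nat.lt_succ_iff.1 (mem_range.1 hm)
    simp only [F]
    rw [← Nat.choose_mul_factorial_mul_factorial hmj]
    have hc : (j.choose m : ℝ) ≠ 0 := by
      have := Nat.choose_pos hmj
      positivity
    have hm := (pochR_pos ha m).ne'
    push_cast
    field_simp
  rw [← hs]
  refine hasSum_sum_of_ne_finset_zero fun m hm => ?_
  have : j < m := by simpa using hm
  simp [F, Nat.choose_eq_zero_of_lt this]

/-- The **Hille–Hardy formula**. -/
theorem hasSum_hilleHardy {a z : ℝ} (ha : 0 < a) (hz : |z| < 1) (x y : ℝ) :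
    HasSum (fun n : ℕ => pochR a n / n.factorial * z ^ n * laguerreR a n x * laguerreR a n y)
      (hilleHardyKernel a z x y) := by
  let K : (ℕ × ℕ) × ℕ → ℝ := fun p => hilleHardyTerm a z x y p.1.1 p.1.2 p.2
  have hnorm (p : (ℕ × ℕ) × ℕ) : ‖K p‖ = hilleHardyTerm a |z| |x| |y| p.1.1 p.1.2 p.2 := by
    simp [K, hilleHardyTerm, abs_of_pos (pochR_pos ha _)]
  have hz' : |(|z|)| < 1 := by rwa [abs_abs]
  have hK : Summable K := by
    refine Summable.of_norm ?_
    refine (summable_prod_of_nonneg fun _ => norm_nonneg _).2 ⟨fun p => ?_, ?_⟩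
    · simp only [hnorm]
      exact (hasSum_hilleHardyTerm ha hz' |x| |y| p.1 p.2).summable
    · simp only [hnorm]
      simp only [(hasSum_hilleHardyTerm ha hz' |x| |y| _ _).tsum_eq]
      exact (hasSum_hilleHardyCoeff ha hz' |x| |y|).summable
  have hsum := hK.hasSum
  rw [(hsum.prod_fiberwise fun p => hasSum_hilleHardyTerm ha hz x y p.1 p.2).unique
    (hasSum_hilleHardyCoeff ha hz x y)] at hsum
  refine ((Equiv.prodComm _ _).hasSum_iff.2 hsum).prod_fiberwise fun n => ?_
  have hs : ∑ p ∈ range (n + 1) ×ˢ range (n + 1), K (p, n) =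
      pochR a n / n.factorial * z ^ n * laguerreR a n x * laguerreR a n y := by
    rw [mul_assoc, laguerreR, laguerreR, sum_mul_sum, ← sum_product', mul_sum]
    refine sum_congr rfl fun p _ => ?_
    simp only [K, hilleHardyTerm]
    ring
  rw [← hs]
  refine hasSum_sum_of_ne_finset_zero fun p hp => ?_
  have : n < p.1 ∨ n < p.2 := by
    by_contra! h
    exact hp (by simpa [Nat.lt_succ_iff] using h)
  rcases this with h | h <;> simp [K, hilleHardyTerm, Nat.choose_eq_zero_of_lt h]

lemma continuousAt_hilleHardyKernel {a : ℝ} (ha : 0 < a) (x y : ℝ) {z : ℝ} (hz : z < 1) :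
    ContinuousAt (fun z => hilleHardyKernel a z x y) z := by
  have h : 1 - z ≠ 0 := by linarith
  have h2 : (1 - z) ^ 2 ≠ 0 := pow_ne_zero 2 h
  unfold hilleHardyKernel
  refine ContinuousAt.mul ?_ (ContinuousAt.mul ?_ ?_)
  · exact ContinuousAt.rpow_const (by fun_prop) (Or.inl h)
  · fun_prop (disch := assumption)
  · exact (continuous_hyp0F1R ha).continuousAt.comp
      (f := fun z : ℝ => x * y * z / (1 - z) ^ 2) (by fun_prop (disch := assumption))

end HilleHardy

section Overlap

open Finset

lemma pochC_ofReal (c : ℝ) (k : ℕ) : pochC c k = pochR c k := by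
  simp [pochC, pochR]

lemma pochC_neg_natCast (n k : ℕ) : pochC (-(n : ℂ)) k = (-1) ^ k * n.descFactorial k := by
  induction k with
  | zero => simp [pochC]
  | succ k ih =>
    rw [pochC, prod_range_succ, ← pochC, ih, Nat.descFactorial_succ]
    rcases le_or_gt k n with h | h
    · push_cast [Nat.cast_sub h]
      ring
    · simp [Nat.descFactorial_eq_zero_iff_lt.2 h]

lemma hyp0F1_ofReal (c y : ℝ) : hyp0F1 c y = hyp0F1R c y := by
  rw [hyp0F1, hyp0F1R, Complex.ofReal_tsum]
  simp [pochC_ofReal]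

lemma sum_pochC_eq_laguerreR (a x : ℝ) (n : ℕ) :
    ∑ k ∈ range (n + 1), pochC (-(n : ℂ)) k / (pochC (a : ℂ) k * (k.factorial : ℂ)) *
      (x : ℂ) ^ (2 * k) = laguerreR a n (-x ^ 2) := by
  rw [laguerreR, Complex.ofReal_sum]
  refine sum_congr rfl fun k _ => ?_
  rw [pochC_neg_natCast, pochC_ofReal, Nat.descFactorial_eq_factorial_mul_choose]
  have : (k.factorial : ℂ) ≠ 0 := Nat.cast_ne_zero.2 k.factorial_ne_zero
  push_cast
  rw [neg_pow ((x : ℂ) ^ 2), pow_mul]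
  field_simp

lemma betaEv_eq (a x : ℝ) (n : ℕ) : betaEv a x n =
    ((-1) ^ n * √(pochR a n / n.factorial) * calB0 a x * laguerreR a n (-x ^ 2) : ℝ) := by
  rw [betaEv, sum_pochC_eq_laguerreR]
  push_cast
  rfl

lemma betaOdd_eq (a x : ℝ) (n : ℕ) : betaOdd a x n =
    ((-1) ^ n * √(pochR (a + 1) n / n.factorial) * calB1 a x *
      laguerreR (a + 1) n (-x ^ 2) : ℝ) := by
  rw [betaOdd, ← Complex.ofReal_one, ← Complex.ofReal_add, sum_pochC_eq_laguerreR]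
  push_cast
  rfl

lemma I_pow_two_mul_mul_pow (t : ℝ) (n : ℕ) :
    Complex.I ^ (2 * n) * (t : ℂ) ^ (2 * n) = (((-t ^ 2) ^ n : ℝ) : ℂ) := by
  rw [pow_mul, pow_mul, Complex.I_sq, ← mul_pow]
  push_cast
  ring

lemma hasSum_overlap {a t : ℝ} (ha : 0 < a) (ht : |t| < 1) (x p : ℝ) :
    HasSum (fun n : ℕ => Complex.I ^ n * betaFn a x n * betaFn a p n * (t : ℂ) ^ n)
      (((calB0 a x * calB0 a p * hilleHardyKernel a (-t ^ 2) (-x ^ 2) (-p ^ 2) : ℝ) : ℂ) +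
        Complex.I * ((t * (calB1 a x * calB1 a p *
          hilleHardyKernel (a + 1) (-t ^ 2) (-x ^ 2) (-p ^ 2)) : ℝ) : ℂ)) := by
  have hz : |(-t ^ 2)| < 1 := by
    rw [abs_neg, abs_pow]
    exact pow_lt_one₀ (abs_nonneg t) ht two_ne_zero
  have hsq {c : ℝ} (hc : 0 < c) (n : ℕ) :
      √(pochR c n / n.factorial) * √(pochR c n / n.factorial) = pochR c n / n.factorial :=
    Real.mul_self_sqrt (by have := pochR_pos hc n; positivity)
  have hsign (n : ℕ) : (-1 : ℝ) ^ n * (-1) ^ n = 1 := by rw [← mul_pow]; simp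
  refine HasSum.even_add_odd ?_ ?_
  · refine (Complex.hasSum_ofReal.2 ((hasSum_hilleHardy ha hz (-x ^ 2) (-p ^ 2)).mul_left
      (calB0 a x * calB0 a p))).congr_fun fun n => ?_
    have h2 : 2 * n / 2 = n := by omega
    simp only [betaFn, if_pos (even_two_mul n), h2, betaEv_eq]
    rw [mul_right_comm, mul_right_comm (Complex.I ^ _), I_pow_two_mul_mul_pow,
      ← Complex.ofReal_mul, ← Complex.ofReal_mul]
    congr 1
    linear_combination ((-t ^ 2) ^ n * √(pochR a n / n.factorial) ^ 2 * calB0 a x * calB0 a p *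
      laguerreR a n (-x ^ 2) * laguerreR a n (-p ^ 2)) * hsign n +
      ((-t ^ 2) ^ n * calB0 a x * calB0 a p *
        laguerreR a n (-x ^ 2) * laguerreR a n (-p ^ 2)) * hsq ha n
  · refine ((Complex.hasSum_ofReal.2 (((hasSum_hilleHardy (by linarith : 0 < a + 1) hz (-x ^ 2)
      (-p ^ 2)).mul_left (calB1 a x * calB1 a p)).mul_left t)).mul_left Complex.I).congr_fun
      fun n => ?_
    have h2 : (2 * n + 1) / 2 = n := by omega
    have hodd : ¬ Even (2 * n + 1) := by simp
    simp only [betaFn, if_neg hodd, h2, betaOdd_eq]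
    rw [pow_succ Complex.I, pow_succ (t : ℂ)]
    have h3 (b c : ℂ) : Complex.I ^ (2 * n) * Complex.I * b * c * ((t : ℂ) ^ (2 * n) * t) =
        Complex.I * (t * ((Complex.I ^ (2 * n) * (t : ℂ) ^ (2 * n)) * b * c)) := by ring
    rw [h3, I_pow_two_mul_mul_pow, ← Complex.ofReal_mul, ← Complex.ofReal_mul,
      ← Complex.ofReal_mul]
    congr 2
    linear_combination (t * (-t ^ 2) ^ n * √(pochR (a + 1) n / n.factorial) ^ 2 * calB1 a x *
      calB1 a p * laguerreR (a + 1) n (-x ^ 2) * laguerreR (a + 1) n (-p ^ 2)) * hsign n +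
      (t * (-t ^ 2) ^ n * calB1 a x * calB1 a p * laguerreR (a + 1) n (-x ^ 2) *
        laguerreR (a + 1) n (-p ^ 2)) * hsq (by linarith : 0 < a + 1) n

lemma hilleHardyKernel_neg_one (a x p : ℝ) :
    hilleHardyKernel a (-1) (-x ^ 2) (-p ^ 2) = Real.exp (x ^ 2 / 2) * Real.exp (p ^ 2 / 2) *
      hyp0F1R a (-x ^ 2 * p ^ 2 / 4) / 2 ^ a := by
  rw [hilleHardyKernel, show (1 : ℝ) - -1 = 2 by norm_num, Real.rpow_neg zero_le_two]
  ring_nf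

lemma calB0_mul_kernel {a : ℝ} (ha : 0 < a) (x p : ℝ) :
    calB0 a x * calB0 a p * hilleHardyKernel a (-1) (-x ^ 2) (-p ^ 2) =
      |x * p| ^ (a - 1 / 2) / (2 ^ a * Real.Gamma a) * hyp0F1R a (-x ^ 2 * p ^ 2 / 4) := by
  have hG := Real.Gamma_pos_of_pos ha
  have hs : √(Real.Gamma a) ≠ 0 := (Real.sqrt_pos.2 hG).ne'
  rw [hilleHardyKernel_neg_one, calB0, calB0, abs_mul,
    Real.mul_rpow (abs_nonneg x) (abs_nonneg p), neg_div, neg_div, Real.exp_neg, Real.exp_neg]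
  nth_rw 3 [← Real.mul_self_sqrt hG.le]
  field_simp

lemma calB1_mul_kernel {a : ℝ} (ha : 0 < a) (x p : ℝ) :
    calB1 a x * calB1 a p * hilleHardyKernel (a + 1) (-1) (-x ^ 2) (-p ^ 2) =
      |x * p| ^ (a - 1 / 2) / (2 ^ a * Real.Gamma a) * (x * p / (2 * a) *
        hyp0F1R (a + 1) (-x ^ 2 * p ^ 2 / 4)) := by
  have hG := Real.Gamma_pos_of_pos ha
  have hG' := Real.Gamma_pos_of_pos (by linarith : 0 < a + 1)
  have hs : √(Real.Gamma (a + 1)) * √(Real.Gamma (a + 1)) = a * Real.Gamma a := by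
    rw [Real.mul_self_sqrt hG'.le, Real.Gamma_add_one ha.ne']
  have h0 : calB1 a x * calB1 a p = x * |x| ^ (a - 1 / 2) * Real.exp (-x ^ 2 / 2) *
      (p * |p| ^ (a - 1 / 2) * Real.exp (-p ^ 2 / 2)) / (a * Real.Gamma a) := by
    rw [calB1, calB1, div_mul_div_comm, hs]
  rw [hilleHardyKernel_neg_one, h0, abs_mul, Real.mul_rpow (abs_nonneg x) (abs_nonneg p),
    neg_div, neg_div, Real.exp_neg, Real.exp_neg, Real.rpow_add_one two_ne_zero]
  field_simp

end Overlap

/-- the Abel limit of the overlap series between the position eigenvector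
`v(x)` and the momentum eigenvector `w(p)` exists and equals
`(|xp|^{a−1/2}/(2^a·Γ(a))) · (₀F₁(−;a;−x²p²/4) + (ixp/(2a))·₀F₁(−;a+1;−x²p²/4))`. -/
theorem abel_limit_position_momentum (a x p : ℝ) (ha : 0 < a) (hx : x ≠ 0) (hp : p ≠ 0) :
    Filter.Tendsto
      (fun t : ℝ => ∑' n : ℕ, Complex.I ^ n * betaFn a x n * betaFn a p n * (t : ℂ) ^ n)
      (nhdsWithin 1 (Set.Iio 1))
      (nhds
        (((|x * p| ^ (a - 1 / 2) : ℝ) : ℂ) / (((2 : ℝ) ^ a * Real.Gamma a : ℝ) : ℂ) *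
          (hyp0F1 (a : ℂ) (-(x : ℂ) ^ 2 * (p : ℂ) ^ 2 / 4)
            + Complex.I * (x : ℂ) * (p : ℂ) / (2 * (a : ℂ)) *
                hyp0F1 ((a : ℂ) + 1) (-(x : ℂ) ^ 2 * (p : ℂ) ^ 2 / 4)))) := by
  have hz : Filter.Tendsto (fun t : ℝ => -t ^ 2) (nhdsWithin 1 (Set.Iio 1)) (nhds (-1)) := by
    have : Continuous fun t : ℝ => -t ^ 2 := by fun_prop
    simpa using (this.tendsto 1).mono_left nhdsWithin_le_nhds
  have ht : Filter.Tendsto (fun t : ℝ => t) (nhdsWithin 1 (Set.Iio 1)) (nhds 1) :=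
    nhdsWithin_le_nhds
  have hev := ((continuousAt_hilleHardyKernel ha (-x ^ 2) (-p ^ 2)
    (by norm_num : (-1 : ℝ) < 1)).tendsto.comp hz).const_mul (calB0 a x * calB0 a p)
  have hodd := ht.mul (((continuousAt_hilleHardyKernel (by linarith : 0 < a + 1) (-x ^ 2) (-p ^ 2)
    (by norm_num : (-1 : ℝ) < 1)).tendsto.comp hz).const_mul (calB1 a x * calB1 a p))
  rw [calB0_mul_kernel ha] at hev
  rw [calB1_mul_kernel ha, one_mul] at hodd
  have h := (Complex.continuous_ofReal.tendsto _ |>.comp hev).add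
    ((Complex.continuous_ofReal.tendsto _ |>.comp hodd).const_mul Complex.I)
  have hy : -(x : ℂ) ^ 2 * (p : ℂ) ^ 2 / 4 = ((-x ^ 2 * p ^ 2 / 4 : ℝ) : ℂ) := by push_cast; rfl
  have ha1 : (a : ℂ) + 1 = ((a + 1 : ℝ) : ℂ) := by push_cast; rfl
  rw [hy, ha1, hyp0F1_ofReal, hyp0F1_ofReal]
  have hlim (P D u v : ℝ) : (P / D : ℂ) * (u + Complex.I * x * p / (2 * a) * v) =
      ((P / D * u : ℝ) : ℂ) + Complex.I * ((P / D * (x * p / (2 * a) * v) : ℝ) : ℂ) := by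
    push_cast
    ring
  rw [hlim]
  refine h.congr' ?_
  filter_upwards [Ioo_mem_nhdsLT (zero_lt_one (α := ℝ))] with t ht
  exact (hasSum_overlap ha (abs_lt.2 ⟨by linarith [ht.1], ht.2⟩) x p).tsum_eq.symm
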